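/- For every 0 ≤ i ≤ d−2, the polynomials c_{i+1}^i and d_{i+1}^i in ℂ[X,Y,Z] are given by the closed formulas c_{i+1}^i = X + (Σ_{r=0}^{i} ζ^r)·Z − (Σ_{r=0}^{i+1} ζ^r)·Y and d_{i+1}^i = (Σ_{r=0}^{i+1} ζ^r)·X − (Σ_{r=1}^{i+1} ζ^r)·Z − ζ^{i+1}·Y. -/

import Mathlib

open MvPolynomial

/-- `P_n(A,B) = ∏_{k=0}^{n} (A - ζ^k B)` for `A, B ∈ ℂ[X,Y,Z]`. -/
noncomputable def P3 (ζ : ℂ) (n : ℕ) (A B : MvPolynomial (Fin 3) ℂ) :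
    MvPolynomial (Fin 3) ℂ :=
  ∏ k ∈ Finset.range (n + 1), (A - C (ζ ^ k) * B)

/-- The polynomials `c_k^i ∈ ℂ[X,Y,Z]` (variables `X = X 0`, `Y = X 1`, `Z = X 2`):
`c_k^k = 1`; for `k ≥ 1`,
`c_k^0 = P_{k-1}(X, ζY) + Σ_{r=0}^{k-2} P_r(Z,Y)·P_{k-2-r}(X, ζ^{r+2}Y) + P_{k-1}(Z,Y)`;
and for `0 < i < k`, `c_k^i = c_{k-1}^{i-1} + c_{k-1}^{i}·ζ^{i}(Z − ζ^{k-i}Y)`. -/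
noncomputable def cc (ζ : ℂ) : ℕ → ℕ → MvPolynomial (Fin 3) ℂ
  | 0, _ => 1
  | (k + 1), 0 =>
      P3 ζ k (X 0) (C ζ * X 1)
        + ∑ r ∈ Finset.range k, P3 ζ r (X 2) (X 1) * P3 ζ (k - 1 - r) (X 0) (C (ζ ^ (r + 2)) * X 1)
        + P3 ζ k (X 2) (X 1)
  | (k + 1), (i + 1) =>
      if i + 1 = k + 1 then 1
      else cc ζ k i + cc ζ k (i + 1) * C (ζ ^ (i + 1)) * (X 2 - C (ζ ^ (k - i)) * X 1)

/-- The polynomials `d_k^j ∈ ℂ[X,Y,Z]`: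
`d_k^k = 1`; for `k ≥ 1`,
`d_k^0 = P_{k-1}(X, ζY) + Σ_{r=0}^{k-2} ζ^{r+1} P_r(X,Z)·P_{k-2-r}(X, ζ^{r+2}Y) + ζ^k P_{k-1}(X,Z)`;
and for `0 < j < k`, `d_k^j = d_{k-1}^{j}·(X − ζ^{k-j}Z) + ζ^{k-j} d_{k-1}^{j-1}`. -/
noncomputable def dd (ζ : ℂ) : ℕ → ℕ → MvPolynomial (Fin 3) ℂ
  | 0, _ => 1
  | (k + 1), 0 =>
      P3 ζ k (X 0) (C ζ * X 1)
        + ∑ r ∈ Finset.range k,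
            C (ζ ^ (r + 1)) * P3 ζ r (X 0) (X 2) * P3 ζ (k - 1 - r) (X 0) (C (ζ ^ (r + 2)) * X 1)
        + C (ζ ^ (k + 1)) * P3 ζ k (X 0) (X 2)
  | (k + 1), (j + 1) =>
      if j + 1 = k + 1 then 1
      else dd ζ k (j + 1) * (X 0 - C (ζ ^ (k - j)) * X 2) + C (ζ ^ (k - j)) * dd ζ k j


theorem cc_diag (ζ : ℂ) (k : ℕ) : cc ζ k k = 1 := by
  cases k <;> simp [cc]

theorem dd_diag (ζ : ℂ) (k : ℕ) : dd ζ k k = 1 := by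
  cases k <;> simp [dd]

theorem icc_geom (ζ : ℂ) (n : ℕ) :
    ∑ r ∈ Finset.Icc 1 n, ζ ^ r = ζ * ∑ r ∈ Finset.range n, ζ ^ r := by
  induction n with
  | zero => simp
  | succ n ih =>
    rw [Finset.sum_Icc_succ_top (by omega), ih, Finset.sum_range_succ]
    ring

theorem cc_formula (ζ : ℂ) (i : ℕ) :
    cc ζ (i + 1) i
        = X 0 + C (∑ r ∈ Finset.range (i + 1), ζ ^ r) * X 2
            - C (∑ r ∈ Finset.range (i + 2), ζ ^ r) * X 1 := by
  induction i with
  | zero =>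
    simp [cc, P3, Finset.sum_range_succ]
    ring
  | succ i ih =>
    have h : cc ζ (i + 1 + 1) (i + 1) = cc ζ (i + 1) i
        + cc ζ (i + 1) (i + 1) * C (ζ ^ (i + 1)) * (X 2 - C (ζ ^ (i + 1 - i)) * X 1) := by
      rw [cc, if_neg (by omega)]
    rw [h, ih, cc_diag, Nat.add_sub_cancel_left, Finset.sum_range_succ _ (i + 1),
      Finset.sum_range_succ _ (i + 2), Finset.sum_range_succ _ (i + 1)]
    simp only [map_add, map_pow]
    ring

theorem dd_formula (ζ : ℂ) (i : ℕ) :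
    dd ζ (i + 1) i
        = C (∑ r ∈ Finset.range (i + 2), ζ ^ r) * X 0
            - C (∑ r ∈ Finset.Icc 1 (i + 1), ζ ^ r) * X 2
            - C (ζ ^ (i + 1)) * X 1 := by
  induction i with
  | zero =>
    simp [dd, P3, Finset.sum_range_succ]
    ring
  | succ i ih =>
    have h : dd ζ (i + 1 + 1) (i + 1) =
        dd ζ (i + 1) (i + 1) * (X 0 - C (ζ ^ (i + 1 - i)) * X 2)
          + C (ζ ^ (i + 1 - i)) * dd ζ (i + 1) i := by
      rw [dd, if_neg (by omega)]
    rw [h, ih, dd_diag, Nat.add_sub_cancel_left, icc_geom, icc_geom,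
      geom_sum_succ (n := i + 2), geom_sum_succ (n := i + 1)]
    simp only [map_add, map_mul, map_pow, map_one]
    ring

/-- closed formulas for `c_{i+1}^i` and `d_{i+1}^i`, for `0 ≤ i ≤ d−2`:
`c_{i+1}^i = X + (Σ_{r=0}^{i} ζ^r)·Z − (Σ_{r=0}^{i+1} ζ^r)·Y` and
`d_{i+1}^i = (Σ_{r=0}^{i+1} ζ^r)·X − (Σ_{r=1}^{i+1} ζ^r)·Z − ζ^{i+1}·Y`. -/
theorem stmt_5 (d : ℕ) (hd : 2 ≤ d) (ζ : ℂ) (hζ : IsPrimitiveRoot ζ d)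
    (i : ℕ) (hi : i ≤ d - 2) :
    cc ζ (i + 1) i
        = X 0 + C (∑ r ∈ Finset.range (i + 1), ζ ^ r) * X 2
            - C (∑ r ∈ Finset.range (i + 2), ζ ^ r) * X 1
    ∧ dd ζ (i + 1) i
        = C (∑ r ∈ Finset.range (i + 2), ζ ^ r) * X 0
            - C (∑ r ∈ Finset.Icc 1 (i + 1), ζ ^ r) * X 2
            - C (ζ ^ (i + 1)) * X 1 := by
  exact ⟨cc_formula ζ i, dd_formula ζ i⟩
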